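/- If 0 < γ < 2(m + α(1 − w_d) + ε)/(M + ε + α(1 − w_m) + α(1 − w_d)), then σ(𝕋_γ) < 1; consequently, for every g ∈ ℝ^{nN} and every initial point d^0 ∈ ℝ^{nN}, the Jacobi Overrelaxation iterates d^{ℓ+1} = 𝕋_γ d^ℓ − γ 𝔻^{-1} g converge, as ℓ → ∞, to the unique solution d* of ℍ d = −g. -/

import Mathlib

open scoped Kronecker RealInnerProductSpace
open Filter Topology

/-- Spectral norm (ℓ2 operator norm) of a real square matrix. -/
noncomputable def specNorm {ι : Type*} [Fintype ι] [DecidableEq ι] (A : Matrix ι ι ℝ) : ℝ :=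
  ‖Matrix.toEuclideanCLM (𝕜 := ℝ) A‖

/-- Action of a matrix on a vector of Euclidean space. -/
noncomputable def mApp {ι : Type*} [Fintype ι] [DecidableEq ι]
    (A : Matrix ι ι ℝ) (x : EuclideanSpace ℝ ι) : EuclideanSpace ℝ ι :=
  Matrix.toEuclideanCLM (𝕜 := ℝ) A x

/-- Spectral radius of a real square matrix (computed over ℂ). -/
noncomputable def specRad {ι : Type*} [Fintype ι] [DecidableEq ι] (A : Matrix ι ι ℝ) : ℝ :=
  (spectralRadius ℂ (A.map (Complex.ofReal : ℝ → ℂ))).toReal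

/-- The matrix 𝕎 = W ⊗ Iₙ. -/
noncomputable def WW (N n : ℕ) (W : Matrix (Fin N) (Fin N) ℝ) :
    Matrix (Fin N × Fin n) (Fin N × Fin n) ℝ :=
  Matrix.kroneckerMap (· * ·) W (1 : Matrix (Fin n) (Fin n) ℝ)

/-- The i-th block component xᵢ ∈ ℝⁿ of x ∈ ℝ^{nN}. -/
noncomputable def comp (N n : ℕ) (x : EuclideanSpace ℝ (Fin N × Fin n)) (i : Fin N) :
    EuclideanSpace ℝ (Fin n) :=
  (EuclideanSpace.equiv (Fin n) ℝ).symm fun j => x (i, j)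

/-- The block-diagonal Hessian ∇²f(x) of f(x) = Σᵢ fᵢ(xᵢ), from local Hessians HF i. -/
noncomputable def blockHess (N n : ℕ)
    (HF : Fin N → EuclideanSpace ℝ (Fin n) → Matrix (Fin n) (Fin n) ℝ)
    (x : EuclideanSpace ℝ (Fin N × Fin n)) :
    Matrix (Fin N × Fin n) (Fin N × Fin n) ℝ :=
  Matrix.of fun p q =>
    if p.1 = q.1 then HF p.1 (comp N n x p.1) p.2 q.2 else 0

/-- The block norm ‖𝕋‖_b = max_i Σ_j ‖T_{ij}‖₂. -/
noncomputable def blockNorm {N n : ℕ} (T : Matrix (Fin N × Fin n) (Fin N × Fin n) ℝ) : ℝ :=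
  ⨆ i : Fin N, ∑ j : Fin N, specNorm (Matrix.of fun (a b : Fin n) => T (i, a) (j, b))

section PowerConvergence

open scoped Matrix.Norms.Operator

/-- A complex Banach algebra element of spectral radius below one has powers tending to zero. -/
theorem tendsto_pow_zero_of_spectralRadius_lt_one {A : Type*} [NormedRing A] [NormedAlgebra ℂ A]
    [CompleteSpace A] {a : A} (ha : spectralRadius ℂ a < 1) :
    Tendsto (fun k : ℕ => a ^ k) atTop (𝓝 0) := by
  obtain ⟨r, har, hr⟩ := exists_between ha
  lift r to NNReal using ne_top_of_lt hr
  have hr1 : r < 1 := by exact_mod_cast hr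
  have hev := (spectrum.pow_nnnorm_pow_one_div_tendsto_nhds_spectralRadius a).eventually_lt_const har
  refine squeeze_zero_norm' ?_
    (tendsto_pow_atTop_nhds_zero_of_lt_one r.coe_nonneg (by exact_mod_cast hr1))
  filter_upwards [hev, eventually_gt_atTop 0] with k hk hk0
  have hk0' : (0 : ℝ) < k := by exact_mod_cast hk0
  have h := ENNReal.rpow_le_rpow hk.le hk0'.le
  rw [← ENNReal.rpow_mul, one_div, inv_mul_cancel₀ hk0'.ne', ENNReal.rpow_one,
    ENNReal.rpow_natCast] at h
  exact_mod_cast h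

variable {ι : Type*} [Fintype ι] [DecidableEq ι]

/-- A bound on the eigenvalues of a complex matrix bounds its spectral radius. -/
theorem Matrix.spectralRadius_lt_one_of_eigenvalue_norm_lt [Nonempty ι] (A : Matrix ι ι ℂ)
    (h : ∀ (z : ℂ) (v : ι → ℂ), v ≠ 0 → A.mulVec v = z • v → ‖z‖ < 1) :
    spectralRadius ℂ A < 1 := by
  refine spectrum.spectralRadius_lt_of_forall_lt A (r := 1) fun z hz => ?_
  rw [← Matrix.spectrum_toLin', ← Module.End.hasEigenvalue_iff_mem_spectrum] at hz
  obtain ⟨v, hv⟩ := hz.exists_hasEigenvector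
  exact_mod_cast h z v hv.2 (by simpa using hv.apply_eq_smul)

theorem Matrix.tendsto_pow_zero_of_spectralRadius_map_ofReal_lt_one (A : Matrix ι ι ℝ)
    (h : spectralRadius ℂ (A.map (Complex.ofReal : ℝ → ℂ)) < 1) :
    Tendsto (fun k : ℕ => A ^ k) atTop (𝓝 0) := by
  have hc := tendsto_pow_zero_of_spectralRadius_lt_one h
  have hre : Continuous fun B : Matrix ι ι ℂ => B.map Complex.re :=
    continuous_id.matrix_map Complex.continuous_re
  have hlim := (hre.tendsto 0).comp hc
  have hpow : ∀ k : ℕ, (A.map (Complex.ofReal : ℝ → ℂ)) ^ k = (A ^ k).map Complex.ofReal :=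
    fun k => (map_pow (Complex.ofRealHom.mapMatrix) A k).symm
  refine (hlim.congr fun k => ?_).trans (by simp)
  ext i j
  simp [hpow]

end PowerConvergence

section Definiteness

open scoped ComplexOrder MatrixOrder

variable {ι κ : Type*} [Fintype ι] [Fintype κ]

variable {W : Matrix ι ι ℝ}

theorem Matrix.IsSymm.sum_mul_add_sq (hW : W.IsSymm) (hrow : ∀ i, ∑ j, W i j = 1) (s : ℝ)
    (v : ι → ℝ) :
    ∑ i, ∑ j, W i j * (v i + s * v j) ^ 2
      = (1 + s ^ 2) * ∑ i, v i ^ 2 + 2 * s * ∑ i, ∑ j, v i * (W i j * v j) := by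
  have h1 : ∑ i, ∑ j, W i j * v i ^ 2 = ∑ i, v i ^ 2 := by
    simp [← Finset.sum_mul, hrow]
  have h2 : ∑ i, ∑ j, W i j * v j ^ 2 = ∑ i, v i ^ 2 := by
    rw [Finset.sum_comm, ← h1]
    exact Finset.sum_congr rfl fun i _ => Finset.sum_congr rfl fun j _ => by rw [hW.apply]
  calc _ = ∑ i, ∑ j, (W i j * v i ^ 2 + s ^ 2 * (W i j * v j ^ 2)
          + 2 * s * (v i * (W i j * v j))) :=
        Finset.sum_congr rfl fun i _ => Finset.sum_congr rfl fun j _ => by ring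
    _ = _ := by
        simp only [Finset.sum_add_distrib, ← Finset.mul_sum, h2]
        rw [h1]
        ring

variable [DecidableEq ι]

theorem Matrix.PosSemidef.map_ofReal {A : Matrix ι ι ℝ} (hA : A.PosSemidef) :
    (A.map (Complex.ofReal : ℝ → ℂ)).PosSemidef := by
  obtain ⟨B, rfl⟩ := CStarAlgebra.nonneg_iff_eq_star_mul_self.mp hA.nonneg
  rw [Matrix.star_eq_conjTranspose]
  have h : (B.conjTranspose * B).map (Complex.ofReal : ℝ → ℂ)
      = (B.map (Complex.ofReal : ℝ → ℂ)).conjTranspose * B.map (Complex.ofReal : ℝ → ℂ) := by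
    ext i j
    simp [Matrix.mul_apply]
  rw [h]
  exact Matrix.posSemidef_conjTranspose_mul_self _

theorem Matrix.PosDef.map_ofReal {A : Matrix ι ι ℝ} (hA : A.PosDef) :
    (A.map (Complex.ofReal : ℝ → ℂ)).PosDef :=
  hA.posSemidef.map_ofReal.posDef_iff_isUnit.mpr (hA.isUnit.map Complex.ofRealHom.mapMatrix)

/-- Spectral radius bound for the relaxed iteration matrix of a splitting with positive definite
`D`, `H` and `2 D - γ H`. -/
theorem Matrix.spectralRadius_relaxation_lt_one [Nonempty ι] {D H : Matrix ι ι ℝ} {γ : ℝ}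
    (hγ : 0 < γ) (hD : D.PosDef) (hH : H.PosDef) (hDH : ((2 : ℝ) • D - γ • H).PosDef) :
    spectralRadius ℂ ((γ • (D⁻¹ * (D - H)) + (1 - γ) • (1 : Matrix ι ι ℝ)).map
      (Complex.ofReal : ℝ → ℂ)) < 1 := by
  set T := γ • (D⁻¹ * (D - H)) + (1 - γ) • (1 : Matrix ι ι ℝ)
  have hDT : D * T = D - γ • H := by
    have hdet : IsUnit D.det := (Matrix.isUnit_iff_isUnit_det _).mp hD.isUnit
    simp only [T, mul_add, Matrix.mul_smul, Matrix.mul_nonsing_inv_cancel_left _ _ hdet, mul_one]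
    module
  refine Matrix.spectralRadius_lt_one_of_eigenvalue_norm_lt _ fun z v hv hz => ?_
  have hq := congrArg (fun B : Matrix ι ι ℝ =>
    star v ⬝ᵥ (B.map (Complex.ofReal : ℝ → ℂ)).mulVec v) hDT
  have hmul : (D * T).map (Complex.ofReal : ℝ → ℂ)
      = D.map (Complex.ofReal : ℝ → ℂ) * T.map (Complex.ofReal : ℝ → ℂ) :=
    Matrix.map_mul (f := Complex.ofRealHom)
  have hsub : ∀ (a b : ℝ), (a • D - b • H).map (Complex.ofReal : ℝ → ℂ)
      = (a : ℂ) • D.map (Complex.ofReal : ℝ → ℂ) - (b : ℂ) • H.map (Complex.ofReal : ℝ → ℂ) := by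
    intro a b
    ext i j
    simp
  have hsub1 := hsub 1 γ
  rw [one_smul] at hsub1
  have hDp := hD.map_ofReal.dotProduct_mulVec_pos hv
  have hHp := hH.map_ofReal.dotProduct_mulVec_pos hv
  have hDHp := hDH.map_ofReal.dotProduct_mulVec_pos hv
  simp only [hmul, hsub1, ← Matrix.mulVec_mulVec, hz, Matrix.mulVec_smul, dotProduct_smul,
    Matrix.sub_mulVec, Matrix.smul_mulVec, dotProduct_sub, smul_eq_mul] at hq
  simp only [hsub, Matrix.sub_mulVec, Matrix.smul_mulVec, dotProduct_smul, dotProduct_sub,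
    smul_eq_mul] at hDHp
  generalize star v ⬝ᵥ (D.map (Complex.ofReal : ℝ → ℂ)).mulVec v = d at *
  generalize star v ⬝ᵥ (H.map (Complex.ofReal : ℝ → ℂ)).mulVec v = h at *
  obtain ⟨hd, hd'⟩ := Complex.pos_iff.mp hDp
  obtain ⟨hh, hh'⟩ := Complex.pos_iff.mp hHp
  lift d to ℝ using hd'.symm
  lift h to ℝ using hh'.symm
  norm_cast at hd hh hDHp
  rw [Complex.ofReal_one, one_mul] at hq
  have hzr : z = ((1 - γ * h / d : ℝ) : ℂ) := by
    have : (d : ℂ) ≠ 0 := by exact_mod_cast hd.ne'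
    push_cast
    field_simp
    linear_combination hq
  rw [hzr, Complex.norm_real, Real.norm_eq_abs, abs_lt]
  have h0 : 0 < γ * h / d := by positivity
  have h2 : γ * h / d < 2 := by
    rw [div_lt_iff₀ hd]
    linarith
  constructor <;> linarith

theorem Matrix.PosSemidef.of_blocks {B : ι → Matrix κ κ ℝ} (hB : ∀ i, (B i).PosSemidef) :
    (Matrix.of fun p q : ι × κ => if p.1 = q.1 then B p.1 p.2 q.2 else 0).PosSemidef := by
  refine .of_dotProduct_mulVec_nonneg ?_ fun v => ?_
  · ext ⟨i, a⟩ ⟨j, b⟩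
    by_cases h : i = j
    · subst h
      simpa using (hB i).isHermitian.apply a b
    · simp [h, Ne.symm h]
  · have h : star v ⬝ᵥ (Matrix.of fun p q : ι × κ => if p.1 = q.1 then B p.1 p.2 q.2 else 0).mulVec v
        = ∑ i, star (fun a => v (i, a)) ⬝ᵥ (B i).mulVec fun a => v (i, a) := by
      simp [dotProduct, Matrix.mulVec, Fintype.sum_prod_type, Finset.sum_ite_irrel]
    rw [h]
    exact Finset.sum_nonneg fun i _ => (hB i).dotProduct_mulVec_nonneg _

theorem Matrix.posSemidef_one_sub_of_stochastic (hW : W.IsSymm) (hnonneg : ∀ i j, 0 ≤ W i j)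
    (hrow : ∀ i, ∑ j, W i j = 1) : (1 - W).PosSemidef := by
  refine .of_dotProduct_mulVec_nonneg (Matrix.isHermitian_one.sub hW) fun v => ?_
  have h := hW.sum_mul_add_sq hrow (-1) v
  have h0 : 0 ≤ ∑ i, ∑ j, W i j * (v i + -1 * v j) ^ 2 :=
    Finset.sum_nonneg fun i _ => Finset.sum_nonneg fun j _ => mul_nonneg (hnonneg i j) (sq_nonneg _)
  have hq : star v ⬝ᵥ (1 - W).mulVec v
      = ∑ i, v i ^ 2 - ∑ i, ∑ j, v i * (W i j * v j) := by
    rw [Matrix.sub_mulVec, dotProduct_sub, Matrix.one_mulVec]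
    simp [dotProduct, Matrix.mulVec, Finset.mul_sum, sq]
  rw [hq]
  linarith

theorem Matrix.posSemidef_one_sub_two_diag_add_of_stochastic (hW : W.IsSymm)
    (hnonneg : ∀ i j, 0 ≤ W i j) (hrow : ∀ i, ∑ j, W i j = 1) :
    (1 - (2 : ℝ) • Matrix.diagonal (fun i => W i i) + W).PosSemidef := by
  refine .of_dotProduct_mulVec_nonneg
    ((Matrix.isHermitian_one.sub ?_).add hW) fun v => ?_
  · ext i j
    by_cases h : i = j
    · simp [h]
    · simp [h, Ne.symm h]
  have h := hW.sum_mul_add_sq hrow 1 v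
  have h0 : ∑ i, 4 * (W i i * v i ^ 2) ≤ ∑ i, ∑ j, W i j * (v i + 1 * v j) ^ 2 :=
    Finset.sum_le_sum fun i _ => by
      refine le_trans (le_of_eq ?_) (Finset.single_le_sum (fun j _ =>
        mul_nonneg (hnonneg i j) (sq_nonneg (v i + 1 * v j))) (Finset.mem_univ i))
      ring
  have hq : star v ⬝ᵥ (1 - (2 : ℝ) • Matrix.diagonal (fun i => W i i) + W).mulVec v
      = ∑ i, v i ^ 2 - 2 * ∑ i, W i i * v i ^ 2 + ∑ i, ∑ j, v i * (W i j * v j) := by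
    rw [Matrix.add_mulVec, dotProduct_add, Matrix.sub_mulVec, dotProduct_sub, Matrix.one_mulVec,
      Matrix.smul_mulVec, dotProduct_smul]
    simp only [dotProduct, Matrix.mulVec_diagonal, smul_eq_mul, star_trivial]
    simp only [Matrix.mulVec, dotProduct, Finset.mul_sum, sq]
    congr 2
    exact Finset.sum_congr rfl fun i _ => by ring
  rw [hq]
  rw [← Finset.mul_sum] at h0
  linarith

end Definiteness

section Iteration

variable {ι : Type*} [Fintype ι] [DecidableEq ι]

theorem mApp_mul (A B : Matrix ι ι ℝ) (v : EuclideanSpace ℝ ι) :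
    mApp (A * B) v = mApp A (mApp B v) := by
  simp [mApp]

theorem mApp_one (v : EuclideanSpace ℝ ι) : mApp 1 v = v := by
  simp [mApp]

theorem tendsto_mApp_zero {A : ℕ → Matrix ι ι ℝ} (hA : Tendsto A atTop (𝓝 0))
    (v : EuclideanSpace ℝ ι) : Tendsto (fun k => mApp (A k) v) atTop (𝓝 0) := by
  have hc : Continuous fun B : Matrix ι ι ℝ => mApp B v := by
    have : (fun B : Matrix ι ι ℝ => mApp B v) = fun B => WithLp.toLp 2 (B.mulVec v.ofLp) := by
      funext B
      exact WithLp.ofLp_injective 2 (Matrix.ofLp_toEuclideanCLM B v)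
    rw [this]
    exact (PiLp.continuous_toLp 2 _).comp (continuous_id.matrix_mulVec continuous_const)
  simpa [mApp, Function.comp_def] using (hc.tendsto 0).comp hA

/-- Affine iterations whose matrix has powers tending to zero converge to any fixed point. -/
theorem tendsto_of_affine_recurrence {T : Matrix ι ι ℝ}
    (hT : Tendsto (fun k : ℕ => T ^ k) atTop (𝓝 0)) {b y : EuclideanSpace ℝ ι}
    (hy : y = mApp T y - b) {d : ℕ → EuclideanSpace ℝ ι} (hd : ∀ k, d (k + 1) = mApp T (d k) - b) :
    Tendsto d atTop (𝓝 y) := by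
  have herr : ∀ k, d k - y = mApp (T ^ k) (d 0 - y) := by
    intro k
    induction k with
    | zero => simp [mApp_one]
    | succ k ih =>
      rw [pow_succ', mApp_mul, ← ih, hd]
      nth_rewrite 1 [hy]
      simp [mApp, map_sub]
  rw [← tendsto_sub_nhds_zero_iff]
  exact (tendsto_mApp_zero hT _).congr fun k => (herr k).symm

end Iteration

section NetworkHessian

variable {N n : ℕ} {W : Matrix (Fin N) (Fin N) ℝ} {m M : ℝ}
  {HF : Fin N → EuclideanSpace ℝ (Fin n) → Matrix (Fin n) (Fin n) ℝ}

theorem posSemidef_blockHess_sub (hlow : ∀ i y, (HF i y - m • 1).PosSemidef)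
    (x : EuclideanSpace ℝ (Fin N × Fin n)) : (blockHess N n HF x - m • 1).PosSemidef := by
  convert Matrix.PosSemidef.of_blocks fun i => hlow i (comp N n x i) using 1
  ext ⟨i, a⟩ ⟨j, b⟩
  by_cases h : i = j <;> simp [blockHess, h, Matrix.one_apply]

theorem posSemidef_sub_blockHess (hup : ∀ i y, (M • 1 - HF i y).PosSemidef)
    (x : EuclideanSpace ℝ (Fin N × Fin n)) : (M • 1 - blockHess N n HF x).PosSemidef := by
  convert Matrix.PosSemidef.of_blocks fun i => hup i (comp N n x i) using 1
  ext ⟨i, a⟩ ⟨j, b⟩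
  by_cases h : i = j <;> simp [blockHess, h, Matrix.one_apply]

theorem posSemidef_one_sub_WW (hW : W.IsSymm) (hnonneg : ∀ i j, 0 ≤ W i j)
    (hrow : ∀ i, ∑ j, W i j = 1) : (1 - WW N n W).PosSemidef := by
  have hkron : 1 - WW N n W = (1 - W) ⊗ₖ (1 : Matrix (Fin n) (Fin n) ℝ) := by
    ext ⟨i, a⟩ ⟨j, b⟩
    by_cases h : i = j <;> by_cases h' : a = b <;> simp [WW, h, h']
  rw [hkron]
  exact (Matrix.posSemidef_one_sub_of_stochastic hW hnonneg hrow).kronecker Matrix.PosSemidef.one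

theorem posSemidef_one_sub_two_diag_add_WW (hW : W.IsSymm) (hnonneg : ∀ i j, 0 ≤ W i j)
    (hrow : ∀ i, ∑ j, W i j = 1) :
    (1 - (2 : ℝ) • Matrix.diagonal (fun p : Fin N × Fin n => W p.1 p.1)
      + WW N n W).PosSemidef := by
  have hkron : 1 - (2 : ℝ) • Matrix.diagonal (fun p : Fin N × Fin n => W p.1 p.1) + WW N n W
      = (1 - (2 : ℝ) • Matrix.diagonal (fun i => W i i) + W)
        ⊗ₖ (1 : Matrix (Fin n) (Fin n) ℝ) := by
    ext ⟨i, a⟩ ⟨j, b⟩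
    by_cases h : i = j <;> by_cases h' : a = b <;>
      simp [WW, h, h']
  rw [hkron]
  exact (Matrix.posSemidef_one_sub_two_diag_add_of_stochastic hW hnonneg hrow).kronecker
    Matrix.PosSemidef.one

end NetworkHessian

theorem stmt10
    (N n : ℕ) (hN : 1 ≤ N) (hn : 1 ≤ n)
    (W : Matrix (Fin N) (Fin N) ℝ)
    (hWsymm : W.IsSymm)
    (hWnonneg : ∀ i j, 0 ≤ W i j)
    (hWrow : ∀ i, ∑ j, W i j = 1)
    (hWcol : ∀ j, ∑ i, W i j = 1)
    (hWdiagpos : ∀ i, 0 < W i i)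
    (m M : ℝ) (hm : 0 < m) (hmM : m ≤ M)
    (F : Fin N → EuclideanSpace ℝ (Fin n) → ℝ)
    (hFsmooth : ∀ i, ContDiff ℝ 2 (F i))
    (HF : Fin N → EuclideanSpace ℝ (Fin n) → Matrix (Fin n) (Fin n) ℝ)
    (hHF : ∀ i y, HasFDerivAt (gradient (F i)) (Matrix.toEuclideanCLM (𝕜 := ℝ) (HF i y)) y)
    (hHFlow : ∀ i y, (HF i y - m • (1 : Matrix (Fin n) (Fin n) ℝ)).PosSemidef)
    (hHFup : ∀ i y, (M • (1 : Matrix (Fin n) (Fin n) ℝ) - HF i y).PosSemidef)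
    (α ε : ℝ) (hα : 0 < α) (hε : 0 < ε)
    (x : EuclideanSpace ℝ (Fin N × Fin n))
    (H : Matrix (Fin N × Fin n) (Fin N × Fin n) ℝ)
    (hH : H = blockHess N n HF x
      + α • ((1 : Matrix (Fin N × Fin n) (Fin N × Fin n) ℝ) - WW N n W) + ε • 1)
    (D G : Matrix (Fin N × Fin n) (Fin N × Fin n) ℝ)
    (hD : D = Matrix.diagonal (fun p => H p p))
    (hG : G = D - H)
    (wd wm : ℝ) (hwd : wd = ⨆ i, W i i) (hwm : wm = ⨅ i, W i i)
    (γ : ℝ) (hγpos : 0 < γ)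
    (hγlt : γ < 2 * (m + α * (1 - wd) + ε) / (M + ε + α * (1 - wm) + α * (1 - wd)))
    (Tγ : Matrix (Fin N × Fin n) (Fin N × Fin n) ℝ)
    (hTγ : Tγ = γ • (D⁻¹ * G) + (1 - γ) • 1) :
    specRad Tγ < 1 ∧
      ∀ g d0 : EuclideanSpace ℝ (Fin N × Fin n),
        ∃ dstar : EuclideanSpace ℝ (Fin N × Fin n),
          mApp H dstar = -g ∧ (∀ d' : EuclideanSpace ℝ (Fin N × Fin n),
            mApp H d' = -g → d' = dstar) ∧
          ∀ dseq : ℕ → EuclideanSpace ℝ (Fin N × Fin n),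
            dseq 0 = d0 →
            (∀ ℓ : ℕ, dseq (ℓ + 1) = mApp Tγ (dseq ℓ) - γ • mApp D⁻¹ g) →
            Filter.Tendsto dseq Filter.atTop (nhds dstar) := by
  have : NeZero N := ⟨by omega⟩
  have : NeZero n := ⟨by omega⟩
  have hwle : ∀ i, W i i ≤ wd := fun i => hwd ▸ le_ciSup (Set.finite_range fun i => W i i).bddAbove i
  have hwge : ∀ i, wm ≤ W i i := fun i => hwm ▸ ciInf_le (Set.finite_range fun i => W i i).bddBelow i
  have hwd1 : wd ≤ 1 := by
    rw [hwd]
    refine ciSup_le fun i => ?_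
    rw [← hWrow i]
    exact Finset.single_le_sum (fun j _ => hWnonneg i j) (Finset.mem_univ i)
  have hLow := posSemidef_blockHess_sub hHFlow x
  have hUp := posSemidef_sub_blockHess hHFup x
  have hL := posSemidef_one_sub_WW (n := n) hWsymm hWnonneg hWrow
  have hL2 := posSemidef_one_sub_two_diag_add_WW (n := n) hWsymm hWnonneg hWrow
  have hHpos : H.PosDef := by
    have h : ((m + ε) • (1 : Matrix (Fin N × Fin n) (Fin N × Fin n) ℝ)).PosDef :=
      Matrix.PosDef.one.smul (by positivity)
    convert (h.add_posSemidef hLow).add_posSemidef (hL.smul hα.le) using 1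
    rw [hH]
    module
  have hDpos : D.PosDef := hD ▸ Matrix.PosDef.diagonal fun p => hHpos.diag_pos
  have hDlow : (D - Matrix.diagonal fun p : Fin N × Fin n => m + ε + α * (1 - W p.1 p.1)).PosSemidef := by
    rw [hD, Matrix.diagonal_sub, Matrix.posSemidef_diagonal_iff]
    intro p
    have := hLow.diag_nonneg (i := p)
    simp [hH, WW] at this ⊢
    linarith
  have hHup : ((Matrix.diagonal fun p : Fin N × Fin n => M + ε + 2 * (α * (1 - W p.1 p.1))) - H).PosSemidef := by
    convert hUp.add (hL2.smul hα.le) using 1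
    rw [hH]
    ext p q
    by_cases h : p = q
    · subst h
      simp
      ring
    · simp [h]
      ring
  have hgap : (Matrix.diagonal fun p : Fin N × Fin n => 2 * (m + ε + α * (1 - W p.1 p.1))
      - γ * (M + ε + 2 * (α * (1 - W p.1 p.1)))).PosDef := by
    refine Matrix.PosDef.diagonal fun p => ?_
    have h1 : α * (1 - wd) ≤ α * (1 - W p.1 p.1) := by gcongr; exact hwle _
    have h2 : α * (1 - W p.1 p.1) ≤ α * (1 - wm) := by gcongr; exact hwge _
    have h0 : 0 ≤ α * (1 - wd) := mul_nonneg hα.le (by linarith)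
    generalize α * (1 - W p.1 p.1) = a at *
    generalize α * (1 - wd) = b at *
    generalize α * (1 - wm) = c at *
    have hB : 0 < M + ε + c + b := by linarith
    rw [lt_div_iff₀ hB] at hγlt
    have hγ2 : γ < 2 := by
      by_contra! h
      nlinarith
    nlinarith [mul_nonneg hγpos.le (sub_nonneg.mpr h2),
      mul_nonneg (sub_nonneg.mpr hγ2.le) (sub_nonneg.mpr h1)]
  have hDH : ((2 : ℝ) • D - γ • H).PosDef := by
    convert (hgap.add_posSemidef (hDlow.smul (zero_le_two (α := ℝ)))).add_posSemidef (hHup.smul hγpos.le)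
      using 1
    ext p q
    by_cases h : p = q
    · subst h
      simp
      ring
    · simp [h]
      ring
  have hrad : spectralRadius ℂ (Tγ.map (Complex.ofReal : ℝ → ℂ)) < 1 := by
    rw [hTγ, hG]
    exact Matrix.spectralRadius_relaxation_lt_one hγpos hDpos hHpos hDH
  refine ⟨?_, fun g d0 => ?_⟩
  · rw [specRad, ← ENNReal.toReal_one]
    exact (ENNReal.toReal_lt_toReal (ne_top_of_lt hrad) ENNReal.one_ne_top).mpr hrad
  have hHdet : IsUnit H.det := (Matrix.isUnit_iff_isUnit_det _).mp hHpos.isUnit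
  have hDdet : IsUnit D.det := (Matrix.isUnit_iff_isUnit_det _).mp hDpos.isUnit
  have hsol : mApp H (mApp H⁻¹ (-g)) = -g := by
    rw [← mApp_mul, Matrix.mul_nonsing_inv _ hHdet, mApp_one]
  refine ⟨mApp H⁻¹ (-g), hsol, fun d' hd' => ?_, fun dseq _ hd => ?_⟩
  · rw [← hd', ← mApp_mul, Matrix.nonsing_inv_mul _ hHdet, mApp_one]
  · refine tendsto_of_affine_recurrence
      (Matrix.tendsto_pow_zero_of_spectralRadius_map_ofReal_lt_one Tγ hrad) ?_ hd
    generalize mApp H⁻¹ (-g) = y at hsol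
    have hT : Tγ = 1 - γ • (D⁻¹ * H) := by
      rw [hTγ, hG, mul_sub, Matrix.nonsing_inv_mul _ hDdet]
      module
    have hTy : mApp Tγ y = y - γ • mApp D⁻¹ (mApp H y) := by
      simp [hT, mApp]
    rw [hTy, hsol]
    simp [mApp]
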